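/- arXiv:2410.16134 — 3 statements merged into one kernel-verified Lean document; each statement's English description precedes it below -/
import Mathlib

section
/- Let (T₁,T₂,T₃) be an anti-commuting triple of invertible contractions on ℂ² satisfying ‖T₁‖ ≤ ‖T₂T₃‖ (operator norms). Then there exist a complex Hilbert space K, unitary operators U₁,U₂,U₃ on K with U_iU_j = −U_jU_i for all 1 ≤ i < j ≤ 3, and a linear isometry V : ℂ² → K such that T₁^{m}T₂^{n}T₃^{r} = V* U₁^{m}U₂^{n}U₃^{r} V for all nonnegative integers m, n, r. -/
/-- The operator norm of a `2 × 2` complex matrix regarded as an operator on the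
Hilbert space `ℂ²` (i.e. `EuclideanSpace ℂ (Fin 2)`, with the `ℓ²` norm). -/
noncomputable def opNorm2 (T : Matrix (Fin 2) (Fin 2) ℂ) : ℝ :=
  ‖Matrix.toEuclideanCLM (𝕜 := ℂ) T‖

section helpers
open ComplexConjugate InnerProductSpace

section ops
variable {K : Type} [NormedAddCommGroup K] [InnerProductSpace ℂ K] [CompleteSpace K]

lemma neumann_aux (x : K →L[ℂ] K) (hx : ‖x‖ < 1) :
    ∃ G : K →L[ℂ] K, (1 - x) * G = 1 ∧ G * (1 - x) = 1 ∧
      (∀ X, X * x = x * X → X * G = G * X) ∧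
      (∀ M : Submodule ℂ K, IsClosed (M : Set K) → (∀ f ∈ M, x f ∈ M) → ∀ f ∈ M, G f ∈ M) := by
  have h1 := mul_neg_geom_series x hx
  have h2 := geom_series_mul_neg x hx
  refine ⟨∑' i : ℕ, x ^ i, h1, h2, ?_, ?_⟩
  · intro X hX
    set G := ∑' i : ℕ, x ^ i
    have h3 : X * (1 - x) = (1 - x) * X := by rw [mul_sub, sub_mul, hX]; simp
    calc X * G = G * (1 - x) * (X * G) := by rw [h2, one_mul]
      _ = G * (X * (1 - x)) * G := by rw [h3]; noncomm_ring
      _ = G * X * ((1 - x) * G) := by noncomm_ring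
      _ = G * X := by rw [h1, mul_one]
  · intro M hM hinv f hf
    have hs : HasSum (fun i : ℕ => x ^ i) (∑' i : ℕ, x ^ i) :=
      (summable_geometric_of_norm_lt_one (x := x) hx).hasSum
    have hs2 : HasSum (fun i : ℕ => (x ^ i) f) ((∑' i : ℕ, x ^ i) f) :=
      hs.mapL (ContinuousLinearMap.apply ℂ K f)
    have hmem : ∀ i : ℕ, (x ^ i) f ∈ M := by
      intro i
      induction i with
      | zero => simpa using hf
      | succ n ih => rw [pow_succ']; exact hinv _ ih
    exact hM.mem_of_tendsto hs2 (Filter.Eventually.of_forall fun s => M.sum_mem fun i _ => hmem i)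

lemma norm_unitary_le {W : K →L[ℂ] K} (hW : W ∈ unitary (K →L[ℂ] K)) : ‖W‖ ≤ 1 :=
  W.opNorm_le_bound zero_le_one fun x => by
    rw [ContinuousLinearMap.norm_map_of_mem_unitary hW, one_mul]

lemma mobius_aux (W : K →L[ℂ] K) (hW : W ∈ unitary (K →L[ℂ] K)) (c : ℂ) (hc : ‖c‖ ≤ 1) :
    ∃ w : K →L[ℂ] K, w ∈ unitary (K →L[ℂ] K) ∧ w + conj c • (W * w) = W + c • 1 ∧
      (∀ X, X * W = W * X → X * w = w * X) ∧
      (∀ M : Submodule ℂ K, IsClosed (M : Set K) → (∀ f ∈ M, W f ∈ M) → ∀ f ∈ M, w f ∈ M) := by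
  obtain ⟨hW1, hW2⟩ := Unitary.mem_iff.1 hW
  rcases hc.lt_or_eq with hc | hc
  · obtain ⟨G, hG1, hG2, hG3, hG4⟩ := neumann_aux (-(conj c • W)) (by
      rw [norm_neg, norm_smul, RCLike.norm_conj]
      calc ‖c‖ * ‖W‖ ≤ ‖c‖ * 1 := by gcongr; exact norm_unitary_le hW
        _ < 1 := by simpa using hc)
    have hcomm : W * G = G * W := hG3 W (by simp)
    have hfac : W + c • 1 = W * star (1 - -(conj c • W)) := by
      simp [mul_add, star_smul, hW2]
    have hst : star (W + c • (1 : K →L[ℂ] K)) * (W + c • 1) =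
        star (1 - -(conj c • W)) * (1 - -(conj c • W)) := by
      simp only [star_add, star_smul, star_one, sub_neg_eq_add, mul_add, add_mul, hW1, one_mul,
        mul_one, smul_mul_assoc, mul_smul_comm, RCLike.star_def, Complex.conj_conj]
      module
    refine ⟨(W + c • 1) * G, ?_, ?_, ?_, ?_⟩
    · refine IsUnit.mem_unitary_of_star_mul_self ?_ ?_
      · rw [hfac]
        have hu : IsUnit (1 - -(conj c • W)) := ⟨⟨_, G, hG1, hG2⟩, rfl⟩
        refine ((?_ : IsUnit W).mul hu.star).mul ⟨⟨G, _, hG2, hG1⟩, rfl⟩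
        exact ⟨⟨W, star W, hW2, hW1⟩, rfl⟩
      · rw [star_mul, mul_assoc, ← mul_assoc _ _ G, hst, mul_assoc, hG1, mul_one, ← star_mul, hG1,
          star_one]
    · have : (W + c • 1) * G + conj c • (W * ((W + c • 1) * G)) =
          (W + c • 1) * ((1 - -(conj c • W)) * G) := by
        simp only [sub_neg_eq_add, mul_add, add_mul, one_mul, mul_one, smul_mul_assoc,
          mul_smul_comm, mul_assoc]
      rw [this, hG1, mul_one]
    · intro X hX
      have := hG3 X (by simp [hX])
      rw [← mul_assoc, mul_add, hX, mul_assoc, add_mul, mul_assoc (W), ← this, ← mul_assoc W]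
      simp [add_mul, mul_assoc, this]
    · intro M hM hi f hf
      have hg := hG4 M hM (fun f hf => by simpa using M.smul_mem (conj c) (hi f hf)) f hf
      simpa using M.add_mem (hi _ hg) (M.smul_mem c hg)
  · have hcc : conj c * c = 1 := by
      rw [Complex.conj_mul']; simp [hc]
    refine ⟨c • 1, ?_, ?_, ?_, ?_⟩
    · rw [Unitary.mem_iff]
      simp [star_smul, smul_smul, hcc, mul_comm c]
    · simp [smul_smul, hcc, add_comm]
    · intro X hX; simp
    · intro M hM hi f hf
      simpa using M.smul_mem c hf
end ops

lemma exists_shift_aux {K : Type} [NormedAddCommGroup K] [InnerProductSpace ℂ K] [CompleteSpace K]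
    (b : HilbertBasis ℤ ℂ K) : ∃ (S R : K →L[ℂ] K) (M : Submodule ℂ K) (e : K),
    S ∈ unitary (K →L[ℂ] K) ∧ R ∈ unitary (K →L[ℂ] K) ∧ star R = R ∧ S * R = -(R * S) ∧
    IsClosed (M : Set K) ∧ e ∈ M ∧ (∀ f ∈ M, S f ∈ M) ∧ (∀ f ∈ M, R f ∈ M) ∧ R e = e ∧
    ‖e‖ = 1 ∧ (∀ f ∈ M, ⟪e, S f⟫_ℂ = 0) ∧ (∀ f ∈ M, ⟪e, f⟫_ℂ = 0 → star S f ∈ M) := by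
  have ext_b : ∀ x y : K, (∀ n, ⟪b n, x⟫_ℂ = ⟪b n, y⟫_ℂ) → x = y := by
    intro x y h
    apply b.repr.injective
    ext n
    simpa [b.repr_apply_apply] using h n
  have hrange : Set.range (b ∘ fun n : ℤ => n + 1) = Set.range b :=
    (Equiv.addRight (1 : ℤ)).surjective.range_comp b
  let b1 : HilbertBasis ℤ ℂ K := HilbertBasis.mk
    (v := b ∘ fun n : ℤ => n + 1) (b.orthonormal.comp _ (add_left_injective 1))
    (by rw [hrange, b.dense_span])
  have hb1 : ∀ n, b1 n = b (n + 1) := fun n => by simp [b1]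
  let σ : ℤ → ℂ := fun n => (-1) ^ n
  have hσ : ∀ n, σ n = 1 ∨ σ n = -1 := fun n => by
    rcases Int.even_or_odd n with h | h
    · left; exact h.neg_one_zpow
    · right; exact h.neg_one_zpow
  have hσ1 : ∀ n, σ (n + 1) = - σ n := fun n => by
    simp only [σ]; rw [zpow_add₀ (by norm_num)]; simp
  have ho := orthonormal_iff_ite.1 b.orthonormal
  let b2 : HilbertBasis ℤ ℂ K := HilbertBasis.mkOfOrthogonalEqBot
    (v := fun n => σ n • b n) (by
      rw [orthonormal_iff_ite]
      intro i j
      rw [inner_smul_left, inner_smul_right, ho]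
      split_ifs with h
      · subst h
        rcases hσ i with h | h <;> simp [h]
      · simp) (by
      rw [eq_bot_iff]
      intro x hx
      rw [Submodule.mem_orthogonal] at hx
      refine ext_b x 0 fun n => ?_
      have := hx (σ n • b n) (Submodule.subset_span ⟨n, rfl⟩)
      rw [inner_smul_left] at this
      rcases hσ n with h | h <;> simpa [h] using this)
  have hb2 : ∀ n, b2 n = σ n • b n := fun n => by simp [b2]
  let eS : K ≃ₗᵢ[ℂ] K := b.repr.trans b1.repr.symm
  let eR : K ≃ₗᵢ[ℂ] K := b.repr.trans b2.repr.symm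
  have heS : ∀ n, eS (b n) = b (n + 1) := fun n => by
    change b1.repr.symm (b.repr (b n)) = _
    rw [b.repr_self, b1.repr_symm_single, hb1]
  have heR : ∀ n, eR (b n) = σ n • b n := fun n => by
    change b2.repr.symm (b.repr (b n)) = _
    rw [b.repr_self, b2.repr_symm_single, hb2]
  have hSb : ∀ n f, ⟪b (n + 1), eS f⟫_ℂ = ⟪b n, f⟫_ℂ := fun n f => by
    rw [← heS, LinearIsometryEquiv.inner_map_map]
  have hRb : ∀ n f, ⟪b n, eR f⟫_ℂ = σ n * ⟪b n, f⟫_ℂ := fun n f => by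
    have h1 : ⟪eR (b n), eR f⟫_ℂ = ⟪b n, f⟫_ℂ := LinearIsometryEquiv.inner_map_map _ _ _
    rw [heR, inner_smul_left] at h1
    rw [← h1]
    rcases hσ n with h | h <;> simp [h]
  let S : K →L[ℂ] K := (eS : K →L[ℂ] K)
  let R : K →L[ℂ] K := (eR : K →L[ℂ] K)
  have hS : S ∈ unitary (K →L[ℂ] K) := (Unitary.linearIsometryEquiv.symm eS).2
  have hR : R ∈ unitary (K →L[ℂ] K) := (Unitary.linearIsometryEquiv.symm eR).2
  have hRR : R * R = 1 := by
    ext1 f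
    refine ext_b _ _ fun n => ?_
    change ⟪b n, eR (eR f)⟫_ℂ = ⟪b n, f⟫_ℂ
    rw [hRb, hRb]
    rcases hσ n with h | h <;> simp [h]
  have hRs : star R = R := by
    calc star R = star R * (R * R) := by rw [hRR, mul_one]
      _ = R := by rw [← mul_assoc, (Unitary.mem_iff.1 hR).1, one_mul]
  have hSs : ∀ n f, ⟪b n, star S f⟫_ℂ = ⟪b (n + 1), f⟫_ℂ := fun n f => by
    rw [ContinuousLinearMap.star_eq_adjoint, ContinuousLinearMap.adjoint_inner_right]
    change ⟪eS (b n), f⟫_ℂ = _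
    rw [heS]
  let M : Submodule ℂ K := ⨅ (n : ℤ) (_ : n < 0), LinearMap.ker (innerSL ℂ (b n) : K →L[ℂ] ℂ).toLinearMap
  have hM : ∀ f, f ∈ M ↔ ∀ n < 0, ⟪b n, f⟫_ℂ = 0 := fun f => by
    simp [M, Submodule.mem_iInf]
  refine ⟨S, R, M, b 0, hS, hR, hRs, ?_, ?_, ?_,
    ?_, ?_, ?_, ?_, ?_, ?_⟩
  · ext1 f
    refine ext_b _ _ fun n => ?_
    obtain ⟨k, rfl⟩ : ∃ k, n = k + 1 := ⟨n - 1, by ring⟩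
    change ⟪b (k + 1), eS (eR f)⟫_ℂ = ⟪b (k + 1), - eR (eS f)⟫_ℂ
    rw [inner_neg_right, hSb, hRb, hRb, hSb, hσ1]
    ring
  · have : (M : Set K) = ⋂ (n : ℤ) (_ : n < 0), {f | ⟪b n, f⟫_ℂ = 0} := by
      ext f; simp [hM]
    rw [this]
    refine isClosed_iInter fun n => isClosed_iInter fun _ => isClosed_eq (by fun_prop) (by fun_prop)
  · rw [hM]
    intro n hn
    rw [ho, if_neg hn.ne]
  · intro f hf
    rw [hM] at hf ⊢
    intro n hn
    obtain ⟨k, rfl⟩ : ∃ k, n = k + 1 := ⟨n - 1, by ring⟩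
    exact (hSb k f).trans (hf _ (by lia))
  · intro f hf
    rw [hM] at hf ⊢
    intro n hn
    exact (hRb n f).trans (by rw [hf _ hn, mul_zero])
  · exact (heR 0).trans (by simp [σ])
  · exact b.orthonormal.1 0
  · intro f hf
    rw [hM] at hf
    have h1 : ⟪b (-1 + 1), S f⟫_ℂ = 0 := (hSb (-1) f).trans (hf _ (by norm_num))
    simpa using h1
  · intro f hf h0
    rw [hM] at hf ⊢
    intro n hn
    rw [hSs]
    rcases eq_or_ne n (-1) with rfl | h
    · simpa using h0
    · exact hf _ (by lia)

lemma exists_shift : ∃ (K : Type) (_ : NormedAddCommGroup K) (_ : InnerProductSpace ℂ K)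
    (_ : CompleteSpace K) (S R : K →L[ℂ] K) (M : Submodule ℂ K) (e : K),
    S ∈ unitary (K →L[ℂ] K) ∧ R ∈ unitary (K →L[ℂ] K) ∧ star R = R ∧ S * R = -(R * S) ∧
    IsClosed (M : Set K) ∧ e ∈ M ∧ (∀ f ∈ M, S f ∈ M) ∧ (∀ f ∈ M, R f ∈ M) ∧ R e = e ∧
    ‖e‖ = 1 ∧ (∀ f ∈ M, ⟪e, S f⟫_ℂ = 0) ∧ (∀ f ∈ M, ⟪e, f⟫_ℂ = 0 → star S f ∈ M) := by
  exact ⟨lp (fun _ : ℤ => ℂ) 2, inferInstance, inferInstance, inferInstance,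
    exists_shift_aux ⟨LinearIsometryEquiv.refl ℂ _⟩⟩

/-- `U` leaves `M` invariant and is intertwined with `T` by `V*` on `M`. -/
def Intw {E K : Type} [NormedAddCommGroup E] [InnerProductSpace ℂ E] [NormedAddCommGroup K]
    [InnerProductSpace ℂ K] (P : K →L[ℂ] E) (M : Submodule ℂ K) (U : K →L[ℂ] K) (T : E →L[ℂ] E) :
    Prop :=
  (∀ f ∈ M, U f ∈ M) ∧ ∀ f ∈ M, P (U f) = T (P f)

section intw
variable {E K : Type} [NormedAddCommGroup E] [InnerProductSpace ℂ E] [NormedAddCommGroup K]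
    [InnerProductSpace ℂ K] {P : K →L[ℂ] E} {M : Submodule ℂ K}

lemma Intw.mul {U U' : K →L[ℂ] K} {T T' : E →L[ℂ] E} (h : Intw P M U T) (h' : Intw P M U' T') :
    Intw P M (U * U') (T * T') := by
  refine ⟨fun f hf => h.1 _ (h'.1 _ hf), fun f hf => ?_⟩
  change P (U (U' f)) = T (T' (P f))
  rw [h.2 _ (h'.1 _ hf), h'.2 _ hf]

lemma Intw.one : Intw P M 1 1 := ⟨fun _ hf => hf, fun _ _ => rfl⟩

lemma Intw.pow {U : K →L[ℂ] K} {T : E →L[ℂ] E} (h : Intw P M U T) (n : ℕ) :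
    Intw P M (U ^ n) (T ^ n) := by
  induction n with
  | zero => simpa using Intw.one
  | succ n ih => rw [pow_succ, pow_succ]; exact ih.mul h
end intw

lemma anti_aux {Q : Type} [Ring Q] {w w' x y : Q} (h1 : x * w' = w' * x) (h2 : y * w = w * y)
    (h3 : w' * w = w * w') (h4 : x * y = -(y * x)) : w * x * (w' * y) = -(w' * y * (w * x)) := by
  calc w * x * (w' * y) = w * (x * w') * y := by noncomm_ring
    _ = w * w' * (x * y) := by rw [h1]; noncomm_ring
    _ = -(w' * (w * y) * x) := by rw [h4, ← h3]; noncomm_ring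
    _ = _ := by rw [← h2]; noncomm_ring

abbrev E2 := EuclideanSpace ℂ (Fin 2)

/-- A model for an anticommuting pair, with a commuting pure unitary `W`. -/
def PairModel (A B : E2 →L[ℂ] E2) : Prop :=
  ∃ (K : Type) (_ : NormedAddCommGroup K) (_ : InnerProductSpace ℂ K) (_ : CompleteSpace K)
    (U U' W : K →L[ℂ] K) (M : Submodule ℂ K) (V : E2 →ₗᵢ[ℂ] K),
    U ∈ unitary (K →L[ℂ] K) ∧ U' ∈ unitary (K →L[ℂ] K) ∧ W ∈ unitary (K →L[ℂ] K) ∧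
    U * U' = -(U' * U) ∧ U * W = W * U ∧ U' * W = W * U' ∧ IsClosed (M : Set K) ∧
    (∀ x, V x ∈ M) ∧
    Intw (ContinuousLinearMap.adjoint V.toContinuousLinearMap) M U A ∧
    Intw (ContinuousLinearMap.adjoint V.toContinuousLinearMap) M U' B ∧
    Intw (ContinuousLinearMap.adjoint V.toContinuousLinearMap) M W 0

lemma PairModel.symm {A B : E2 →L[ℂ] E2} (h : PairModel A B) : PairModel B A := by
  obtain ⟨K, _, _, _, U, U', W, M, V, h1, h2, h3, h4, h5, h6, h7, h8, h9, h10, h11⟩ := h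
  exact ⟨K, _, _, ‹_›, U', U, W, M, V, h2, h1, h3, by rw [h4, neg_neg], h6, h5, h7, h8, h10, h9, h11⟩

lemma PairModel.dilate {A B : E2 →L[ℂ] E2} (h : PairModel A B) (c₁ c₂ c₃ : ℂ)
    (hc₁ : ‖c₁‖ ≤ 1) (hc₂ : ‖c₂‖ ≤ 1) (hc₃ : ‖c₃‖ ≤ 1) :
    ∃ (K : Type) (_ : NormedAddCommGroup K) (_ : InnerProductSpace ℂ K) (_ : CompleteSpace K)
      (U₁ U₂ U₃ : K →L[ℂ] K) (V : E2 →ₗᵢ[ℂ] K),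
      U₁ ∈ unitary (K →L[ℂ] K) ∧ U₂ ∈ unitary (K →L[ℂ] K) ∧ U₃ ∈ unitary (K →L[ℂ] K) ∧
      U₁ * U₂ = -(U₂ * U₁) ∧ U₁ * U₃ = -(U₃ * U₁) ∧ U₂ * U₃ = -(U₃ * U₂) ∧
      (∀ m n r : ℕ, (c₁ • (A * B)) ^ m * (c₂ • A) ^ n * (c₃ • B) ^ r =
          (ContinuousLinearMap.adjoint V.toContinuousLinearMap) ∘L
            (U₁ ^ m * U₂ ^ n * U₃ ^ r) ∘L V.toContinuousLinearMap) := by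
  obtain ⟨K, _, _, _, U, U', W, M, V, hU, hU', hW, hUU', hUW, hUW', hM, hVM, iU, iU', iW⟩ := h
  set P := ContinuousLinearMap.adjoint V.toContinuousLinearMap with hP
  have key : ∀ c : ℂ, ‖c‖ ≤ 1 → ∃ w : K →L[ℂ] K, w ∈ unitary (K →L[ℂ] K) ∧
      (∀ X, X * W = W * X → X * w = w * X) ∧ Intw P M w (c • 1) := by
    intro c hc
    obtain ⟨w, h1, h2, h3, h4⟩ := mobius_aux W hW c hc
    have h5 := h4 M hM iW.1
    refine ⟨w, h1, h3, h5, fun f hf => ?_⟩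
    have h6 := congrArg (fun X : K →L[ℂ] K => P (X f)) h2
    simp only [ContinuousLinearMap.add_apply, ContinuousLinearMap.smul_apply, map_add, map_smul,
      ContinuousLinearMap.mul_apply, ContinuousLinearMap.one_apply] at h6
    rw [iW.2 _ (h5 f hf), iW.2 _ hf] at h6
    simpa using h6
  obtain ⟨w₁, u₁, k₁, i₁⟩ := key c₁ hc₁
  obtain ⟨w₂, u₂, k₂, i₂⟩ := key c₂ hc₂
  obtain ⟨w₃, u₃, k₃, i₃⟩ := key c₃ hc₃
  have a1 := k₁ U hUW
  have a1' := k₁ U' hUW'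
  have a2 := k₂ U hUW
  have a2' := k₂ U' hUW'
  have a3 := k₃ U hUW
  have a3' := k₃ U' hUW'
  have b12 := k₁ w₂ (k₂ W rfl).symm
  have b13 := k₁ w₃ (k₃ W rfl).symm
  have b23 := k₂ w₃ (k₃ W rfl).symm
  have I₁ : Intw P M (w₁ * (U * U')) (c₁ • (A * B)) := by
    have := i₁.mul (iU.mul iU'); simpa using this
  have I₂ : Intw P M (w₂ * U) (c₂ • A) := by
    have := i₂.mul iU; simpa using this
  have I₃ : Intw P M (w₃ * U') (c₃ • B) := by
    have := i₃.mul iU'; simpa using this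
  refine ⟨K, _, _, ‹_›, w₁ * (U * U'), w₂ * U, w₃ * U', V, mul_mem u₁ (mul_mem hU hU'),
    mul_mem u₂ hU, mul_mem u₃ hU', ?_, ?_, ?_, ?_⟩
  · refine anti_aux ?_ a1 b12 ?_
    · rw [mul_assoc, a2', ← mul_assoc, a2, mul_assoc]
    · rw [mul_assoc, ← neg_neg (U' * U), ← hUU', mul_neg]
  · refine anti_aux ?_ a1' b13 ?_
    · rw [mul_assoc, a3', ← mul_assoc, a3, mul_assoc]
    · rw [← mul_assoc U' U U', ← neg_mul, ← hUU']
  · exact anti_aux a3 a2' b23 hUU'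
  · intro m n r
    have I := ((I₁.pow m).mul (I₂.pow n)).mul (I₃.pow r)
    ext1 x
    have h1 := I.2 (V x) (hVM x)
    have h2 : P (V x) = x := by
      refine ext_inner_left ℂ fun y => ?_
      rw [hP, ContinuousLinearMap.adjoint_inner_right]
      exact V.inner_map_map y x
    rw [h2] at h1
    exact h1.symm

section models
variable {K : Type} [NormedAddCommGroup K] [InnerProductSpace ℂ K] [CompleteSpace K]

lemma exists_V (u u' : E2) (g h : K) (ρ : ℂ) (hg : ⟪g, g⟫_ℂ = ρ) (hh : ⟪h, h⟫_ℂ = ρ)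
    (hgh : ⟪g, h⟫_ℂ = 0) (hu : ∀ x : E2, ρ • (⟪u, x⟫_ℂ • u + ⟪u', x⟫_ℂ • u') = x) :
    ∃ V : E2 →ₗᵢ[ℂ] K, (∀ x, V x = ⟪u, x⟫_ℂ • g + ⟪u', x⟫_ℂ • h) ∧
      ∀ f, ContinuousLinearMap.adjoint V.toContinuousLinearMap f =
        ⟪g, f⟫_ℂ • u + ⟪h, f⟫_ℂ • u' := by
  let L : E2 →ₗ[ℂ] K :=
    { toFun := fun x => ⟪u, x⟫_ℂ • g + ⟪u', x⟫_ℂ • h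
      map_add' := fun x y => by simp only [inner_add_right]; module
      map_smul' := fun c x => by simp only [inner_smul_right, RingHom.id_apply]; module }
  have hL : ∀ x, L x = ⟪u, x⟫_ℂ • g + ⟪u', x⟫_ℂ • h := fun _ => rfl
  have hhg : ⟪h, g⟫_ℂ = 0 := inner_eq_zero_symm.1 hgh
  have hin : ∀ x, ⟪L x, L x⟫_ℂ = ⟪x, x⟫_ℂ := fun x => by
    have h0 := congrArg (fun y => ⟪x, y⟫_ℂ) (hu x)
    simp only [inner_smul_right, inner_add_right] at h0
    rw [hL]
    simp only [inner_add_left, inner_add_right, inner_smul_left, inner_smul_right, hg, hh, hgh, hhg,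
      inner_conj_symm]
    linear_combination h0
  let V : E2 →ₗᵢ[ℂ] K := ⟨L, fun x => by
    have h1 := hin x
    rw [inner_self_eq_norm_sq_to_K, inner_self_eq_norm_sq_to_K] at h1
    have h2 : ‖L x‖ ^ 2 = ‖x‖ ^ 2 := by exact_mod_cast h1
    exact (pow_left_inj₀ (norm_nonneg _) (norm_nonneg _) two_ne_zero).1 h2⟩
  refine ⟨V, fun x => rfl, fun f => ?_⟩
  refine ext_inner_left ℂ fun y => ?_
  rw [ContinuousLinearMap.adjoint_inner_right]
  change ⟪⟪u, y⟫_ℂ • g + ⟪u', y⟫_ℂ • h, f⟫_ℂ = _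
  simp only [inner_add_left, inner_add_right, inner_smul_left, inner_smul_right, inner_conj_symm]
  ring

lemma inner_star {U : K →L[ℂ] K} (x y : K) : ⟪U x, y⟫_ℂ = ⟪x, star U y⟫_ℂ := by
  rw [ContinuousLinearMap.star_eq_adjoint, ContinuousLinearMap.adjoint_inner_right]

end models

lemma unitary_model (A B : E2 →L[ℂ] E2) (α β : ℂ) (hα : ‖α‖ = 1) (hβ : ‖β‖ = 1) (v v' : E2)
    (h1 : A v = α • v) (h2 : A v' = -(α • v')) (h3 : B v = β • v') (h4 : B v' = β • v)
    (hv : ∀ x : E2, ⟪v, x⟫_ℂ • v + ⟪v', x⟫_ℂ • v' = x) : PairModel A B := by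
  obtain ⟨K, _, _, _, S, R, M, e, hS, hR, hRs, hSR, hM, he, hSM, hRM, hRe, hne, heS, heM⟩ :=
    exists_shift
  obtain ⟨hS1, hS2⟩ := Unitary.mem_iff.1 hS
  have hRR : R * R = 1 := by
    have := (Unitary.mem_iff.1 hR).1; rwa [hRs] at this
  have hRS' : R * star S = -(star S * R) := by
    have := congrArg star hSR
    simpa [hRs] using this
  have hRS : R * S = -(S * R) := by rw [hSR, neg_neg]
  have hee : ⟪e, e⟫_ℂ = 1 := by rw [inner_self_eq_norm_sq_to_K, hne]; simp
  obtain ⟨V, hV, hV'⟩ := exists_V v v' e (S e) 1 hee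
    (by rw [ContinuousLinearMap.inner_map_map_of_mem_unitary hS, hee]) (heS e he)
    (fun x => by rw [one_smul, hv])
  set J : K →L[ℂ] K := (1 / 2 : ℂ) • (S * (1 + R) + star S * (1 - R)) with hJ
  have hJs : star J = J := by
    simp only [hJ, star_smul, star_add, star_mul, star_star, star_one, star_sub, hRs, add_mul,
      sub_mul, mul_add, mul_sub, mul_one, one_mul, hRS, hRS']
    simp
    module
  have t1 : (1 + R) * S = S * (1 - R) := by rw [add_mul, hRS]; noncomm_ring
  have t2 : (1 - R) * S = S * (1 + R) := by rw [sub_mul, hRS]; noncomm_ring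
  have t3 : (1 + R) * star S = star S * (1 - R) := by rw [add_mul, hRS']; noncomm_ring
  have t4 : (1 - R) * star S = star S * (1 + R) := by rw [sub_mul, hRS']; noncomm_ring
  have z1 : (1 - R) * (1 + R) = 0 := by
    have : (1 - R) * (1 + R) = 1 - R * R := by noncomm_ring
    rw [this, hRR, sub_self]
  have z2 : (1 + R) * (1 - R) = 0 := by
    have : (1 + R) * (1 - R) = 1 - R * R := by noncomm_ring
    rw [this, hRR, sub_self]
  have z3 : (1 - R) * (1 - R) = (2 : ℂ) • (1 - R) := by
    have : (1 - R) * (1 - R) = 1 - (2 : ℕ) • R + R * R := by noncomm_ring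
    rw [this, hRR]; module
  have z4 : (1 + R) * (1 + R) = (2 : ℂ) • (1 + R) := by
    have : (1 + R) * (1 + R) = 1 + (2 : ℕ) • R + R * R := by noncomm_ring
    rw [this, hRR]; module
  have hJJ : J * J = 1 := by
    have : (S * (1 + R) + star S * (1 - R)) * (S * (1 + R) + star S * (1 - R)) = (4 : ℂ) • 1 := by
      calc _ = S * ((1 + R) * S) * (1 + R) + S * ((1 + R) * star S) * (1 - R)
            + star S * ((1 - R) * S) * (1 + R) + star S * ((1 - R) * star S) * (1 - R) := by
              noncomm_ring
        _ = S * S * ((1 - R) * (1 + R)) + (S * star S) * ((1 - R) * (1 - R))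
            + (star S * S) * ((1 + R) * (1 + R)) + star S * star S * ((1 + R) * (1 - R)) := by
              rw [t1, t2, t3, t4]; noncomm_ring
        _ = (4 : ℂ) • 1 := by
              rw [z1, z2, z3, z4, hS1, hS2, one_mul, one_mul, mul_zero, mul_zero]; module
    rw [hJ, smul_mul_smul_comm, this]
    module
  have hJu : J ∈ unitary (K →L[ℂ] K) := by rw [Unitary.mem_iff, hJs]; exact ⟨hJJ, hJJ⟩
  have hRJ : R * J = -(J * R) := by
    simp only [hJ, mul_smul_comm, smul_mul_assoc, mul_add, mul_sub, add_mul, sub_mul, mul_one,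
      ← mul_assoc, hRS, hRS', neg_mul]
    module
  have hsc : ∀ α : ℂ, ‖α‖ = 1 → ∀ U ∈ unitary (K →L[ℂ] K), α • U ∈ unitary (K →L[ℂ] K) := by
    intro α hα U hU
    have hcc : conj α * α = 1 := by rw [Complex.conj_mul']; simp [hα]
    rw [Unitary.mem_iff] at hU ⊢
    simp [star_smul, smul_smul, hcc, mul_comm α, hU.1, hU.2]
  have cSR : R * (S * S) = S * S * R := by
    rw [← mul_assoc, hRS, neg_mul, mul_assoc, hRS]; noncomm_ring
  have cSJ : J * (S * S) = S * S * J := by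
    have q1 : S * (1 + R) * (S * S) = S * S * (S * (1 + R)) := by
      rw [mul_assoc, add_mul, cSR]; noncomm_ring
    have q2 : star S * (1 - R) * (S * S) = S * S * (star S * (1 - R)) := by
      calc star S * (1 - R) * (S * S) = star S * (S * S - R * (S * S)) := by noncomm_ring
        _ = (star S * S) * S * (1 - R) := by rw [cSR]; noncomm_ring
        _ = S * (S * star S) * (1 - R) := by rw [hS1, hS2]; noncomm_ring
        _ = _ := by noncomm_ring
    rw [hJ, smul_mul_assoc, mul_smul_comm, add_mul, q1, q2, ← mul_add]
  have hJe : J e = S e := by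
    simp only [hJ, ContinuousLinearMap.smul_apply, ContinuousLinearMap.add_apply,
      ContinuousLinearMap.mul_apply, ContinuousLinearMap.sub_apply, ContinuousLinearMap.one_apply,
      hRe, sub_self, map_zero, map_add]
    module
  have hJSe : J (S e) = e := by
    rw [← hJe]; exact congrArg (fun X : K →L[ℂ] K => X e) hJJ
  have hRSe : R (S e) = -S e := by
    have := congrArg (fun X : K →L[ℂ] K => X e) hRS
    simpa [hRe] using this
  have hinR : ∀ x y, ⟪x, R y⟫_ℂ = ⟪R x, y⟫_ℂ := fun x y => by rw [inner_star, hRs]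
  have hinJ : ∀ x y, ⟪x, J y⟫_ℂ = ⟪J x, y⟫_ℂ := fun x y => by rw [inner_star, hJs]
  have hJM : ∀ f ∈ M, J f ∈ M := by
    intro f hf
    refine M.smul_mem _ (M.add_mem (hSM _ (M.add_mem hf (hRM f hf)))
      (heM _ (M.sub_mem hf (hRM f hf)) ?_))
    simp [inner_sub_right, hinR, hRe]
  refine ⟨K, _, _, ‹_›, α • R, β • J, S * S, M, V, hsc α hα R hR, hsc β hβ J hJu, mul_mem hS hS,
    ?_, ?_, ?_, hM, ?_, ?_, ?_, ?_⟩
  · rw [smul_mul_smul_comm, smul_mul_smul_comm, hRJ, smul_neg, mul_comm α]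
  · rw [smul_mul_assoc, mul_smul_comm, cSR]
  · rw [smul_mul_assoc, mul_smul_comm, cSJ]
  · intro x
    rw [hV]
    exact M.add_mem (M.smul_mem _ he) (M.smul_mem _ (hSM _ he))
  · refine ⟨fun f hf => M.smul_mem _ (hRM f hf), fun f hf => ?_⟩
    simp only [hV', ContinuousLinearMap.smul_apply, inner_smul_right, hinR, hRe, hRSe, map_add,
      map_smul, h1, h2, inner_neg_left]
    module
  · refine ⟨fun f hf => M.smul_mem _ (hJM f hf), fun f hf => ?_⟩
    simp only [hV', ContinuousLinearMap.smul_apply, inner_smul_right, hinJ, hJe, hJSe, map_add,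
      map_smul, h3, h4]
    module
  · refine ⟨fun f hf => hSM _ (hSM _ hf), fun f hf => ?_⟩
    simp only [hV', ContinuousLinearMap.mul_apply,
      ContinuousLinearMap.inner_map_map_of_mem_unitary hS]
    simp [heS _ (hSM _ hf), heS f hf]

lemma pure_model (A B : E2 →L[ℂ] E2) (a c κ : ℂ) (d : E2) (ha : ‖a‖ < 1) (hA : A * A = a • 1)
    (hAB : A * B = -(B * A))
    (hd : ∀ x : E2, ⟪d, x⟫_ℂ • d + ⟪A d, x⟫_ℂ • A d = (1 - conj a * a) • x)
    (hc : ‖c‖ ≤ 1) (hκ : ‖κ‖ = 1) (hB : B d + conj c • A (B d) = κ • (A d + c • d)) :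
    PairModel A B := by
  obtain ⟨K, _, _, _, S, R, M, e, hS, hR, hRs, hSR, hM, he, hSM, hRM, hRe, hne, heS, heM⟩ :=
    exists_shift
  have hAA : ∀ x, A (A x) = a • x := fun x => congrArg (fun X : E2 →L[ℂ] E2 => X x) hA
  have hBA : ∀ x, B (A x) = - A (B x) := fun x => by
    have := congrArg (fun X : E2 →L[ℂ] E2 => X x) hAB
    simp only [ContinuousLinearMap.mul_apply, ContinuousLinearMap.neg_apply] at this
    rw [this, neg_neg]
  have hRS : R * S = -(S * R) := by rw [hSR, neg_neg]
  have hS2 : S * S ∈ unitary (K →L[ℂ] K) := mul_mem hS hS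
  have cSR : R * (S * S) = S * S * R := by
    rw [← mul_assoc, hRS, neg_mul, mul_assoc, hRS]; noncomm_ring
  have hee : ⟪e, e⟫_ℂ = 1 := by rw [inner_self_eq_norm_sq_to_K, hne]; simp
  have hinS : ∀ x y, ⟪S x, S y⟫_ℂ = ⟪x, y⟫_ℂ :=
    ContinuousLinearMap.inner_map_map_of_mem_unitary hS
  have hinR : ∀ x y, ⟪x, R y⟫_ℂ = ⟪R x, y⟫_ℂ := fun x y => by rw [inner_star, hRs]
  have haa : conj a * a ≠ 1 := by
    rw [Complex.conj_mul']
    intro h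
    have : ‖a‖ ^ 2 = 1 := by exact_mod_cast h
    nlinarith [norm_nonneg a]
  have haa' : 1 - conj a * a ≠ 0 := sub_ne_zero.2 haa.symm
  obtain ⟨G, hG1, hG2, hG3, hG4⟩ := neumann_aux (conj a • (S * S)) (by
      rw [norm_smul, RCLike.norm_conj]
      calc ‖a‖ * ‖S * S‖ ≤ ‖a‖ * 1 := by gcongr; exact norm_unitary_le hS2
        _ < 1 := by simpa using ha)
  set g : K := G e with hg
  have hgM : g ∈ M := hG4 M hM (fun f hf => M.smul_mem _ (hSM _ (hSM _ hf))) e he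
  have hge : g = e + conj a • S (S g) := by
    have := congrArg (fun X : K →L[ℂ] K => X e) hG1
    simp only [ContinuousLinearMap.mul_apply, ContinuousLinearMap.sub_apply,
      ContinuousLinearMap.smul_apply, ContinuousLinearMap.one_apply] at this
    rw [← this]; abel
  have hRg : R g = g := by
    have := congrArg (fun X : K →L[ℂ] K => X e) (hG3 R (by rw [mul_smul_comm, smul_mul_assoc, cSR]))
    simpa [hRe] using this
  have hRSx : ∀ x, R (S x) = -S (R x) := fun x => congrArg (fun X : K →L[ℂ] K => X x) hRS
  have hgg : ⟪g, g⟫_ℂ = (1 - conj a * a)⁻¹ := by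
    have h1 : ⟪g, g⟫_ℂ = 1 + conj a * a * ⟪g, g⟫_ℂ := by
      conv_lhs => rw [hge]
      have z1 : ⟪e, S (S g)⟫_ℂ = 0 := heS _ (hSM _ hgM)
      have z2 : ⟪S (S g), e⟫_ℂ = 0 := inner_eq_zero_symm.1 z1
      simp only [inner_add_left, inner_add_right, inner_smul_left, inner_smul_right, hee, z1, z2,
        hinS, Complex.conj_conj]
      ring
    field_simp
    linear_combination h1
  have hgS : ⟪g, S g⟫_ℂ = 0 := by
    have h1 : ⟪g, S g⟫_ℂ = -⟪g, S g⟫_ℂ := by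
      calc ⟪g, S g⟫_ℂ = ⟪R g, S g⟫_ℂ := by rw [hRg]
        _ = -⟪g, S g⟫_ℂ := by rw [← hinR, hRSx, hRg, inner_neg_right]
    exact self_eq_neg.1 h1
  obtain ⟨V, hV, hV'⟩ := exists_V d (A d) g (S g) _ hgg (by rw [hinS, hgg]) hgS
    (fun x => by rw [hd, smul_smul, inv_mul_cancel₀ haa', one_smul])
  have iS : Intw (ContinuousLinearMap.adjoint V.toContinuousLinearMap) M S A := by
    refine ⟨hSM, fun f hf => ?_⟩
    have h1 : ⟪g, S f⟫_ℂ = a * ⟪S g, f⟫_ℂ := by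
      conv_lhs => rw [hge]
      simp only [inner_add_left, inner_smul_left, hinS, heS f hf, Complex.conj_conj, zero_add]
    simp only [hV', map_add, map_smul, hAA, hinS, h1]
    module
  have iS2 := iS.mul iS
  have hinj : ∀ y : E2, y + conj c • A y = 0 → y = 0 := by
    intro y hy
    have h1 : y = -(conj c • A y) := eq_neg_of_add_eq_zero_left hy
    have h2 : A y = -(conj c • a • y) := by
      have := congrArg A h1
      rwa [map_neg, map_smul, hAA] at this
    rw [h2] at h1
    have h3 : (1 - conj c * conj c * a) • y = 0 := by
      rw [sub_smul, one_smul]; nth_rewrite 1 [h1]; module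
    rcases smul_eq_zero.1 h3 with h | h
    · exfalso
      have : ‖conj c * conj c * a‖ = 1 := by rw [← sub_eq_zero.1 h]; simp
      rw [norm_mul, norm_mul, RCLike.norm_conj] at this
      have : ‖c‖ * ‖c‖ ≤ 1 := by nlinarith [norm_nonneg c]
      nlinarith [norm_nonneg a, norm_nonneg c]
    · exact h
  obtain ⟨w, u, k, k', l⟩ := mobius_aux S hS c hc
  obtain ⟨W, hWu, hWk, hWc, hWM⟩ := mobius_aux (S * S) hS2 (-a) (by simpa using ha.le)
  have hwM := l M hM hSM
  have hSSM : ∀ f ∈ M, (S * S) f ∈ M := fun f hf => hSM _ (hSM _ hf)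
  have hWM' := hWM M hM hSSM
  have cWR := hWc R cSR
  have cWS := hWc S (by noncomm_ring)
  have cWw := k' W cWS.symm
  have hsc : κ • (w * R) ∈ unitary (K →L[ℂ] K) := by
    have hU := mul_mem u hR
    have hcc : conj κ * κ = 1 := by rw [Complex.conj_mul']; simp [hκ]
    rw [Unitary.mem_iff] at hU ⊢
    rw [star_smul, smul_mul_smul_comm, smul_mul_smul_comm, hU.1, hU.2]
    simp [hcc, mul_comm κ]
  have cSw := k' S rfl
  refine ⟨K, _, _, ‹_›, S, κ • (w * R), W, M, V, hS, hsc, hWu, ?_, cWS, ?_, hM, ?_, iS, ?_, ?_⟩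
  · rw [mul_smul_comm, smul_mul_assoc, ← mul_assoc, cSw, mul_assoc, hSR, mul_neg, smul_neg,
      mul_assoc]
  · rw [mul_smul_comm, smul_mul_assoc, mul_assoc, cWR, ← mul_assoc, ← cWw, mul_assoc]
  · intro x
    rw [hV]
    exact M.add_mem (M.smul_mem _ hgM) (M.smul_mem _ (hSM _ hgM))
  · refine ⟨fun f hf => M.smul_mem _ (hwM _ (hRM _ hf)), fun f hf => ?_⟩
    rw [← sub_eq_zero]
    apply hinj
    have h6 := congrArg (fun X : K →L[ℂ] K =>
      ContinuousLinearMap.adjoint V.toContinuousLinearMap (X (R f))) k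
    simp only [ContinuousLinearMap.add_apply, ContinuousLinearMap.smul_apply, map_add, map_smul,
      ContinuousLinearMap.mul_apply, ContinuousLinearMap.one_apply] at h6
    rw [iS.2 _ (hwM _ (hRM _ hf)), iS.2 _ (hRM _ hf)] at h6
    have h7 : ContinuousLinearMap.adjoint V.toContinuousLinearMap (R f) =
        ⟪g, f⟫_ℂ • d - ⟪S g, f⟫_ℂ • A d := by
      rw [hV', hinR, hinR, hRSx, hRg, inner_neg_left]; module
    simp only [ContinuousLinearMap.smul_apply, ContinuousLinearMap.mul_apply, map_smul, map_sub]
    set y := ContinuousLinearMap.adjoint V.toContinuousLinearMap (w (R f))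
    rw [h7] at h6
    rw [hV' f]
    simp only [map_add, map_smul, map_sub, map_neg, hBA, hAA] at h6 ⊢
    have hB2 := congrArg A hB
    simp only [map_add, map_smul, hAA] at hB2
    linear_combination (norm := module) κ • h6 - ⟪g, f⟫_ℂ • hB + ⟪S g, f⟫_ℂ • hB2
  · refine ⟨hWM', fun f hf => ?_⟩
    have h6 := congrArg (fun X : K →L[ℂ] K =>
      ContinuousLinearMap.adjoint V.toContinuousLinearMap (X f)) hWk
    have h8 := iS2.2 _ (hWM' f hf)
    have h9 := iS2.2 _ hf
    rw [hA] at h8 h9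
    simp only [ContinuousLinearMap.add_apply, ContinuousLinearMap.smul_apply, map_add, map_smul,
      ContinuousLinearMap.mul_apply, ContinuousLinearMap.one_apply] at h6 h8 h9
    rw [h8, h9, map_neg, smul_smul] at h6
    have h10 : (1 - conj a * a) • ContinuousLinearMap.adjoint V.toContinuousLinearMap (W f) = 0 := by
      linear_combination (norm := module) h6
    simpa [haa'] using h10

section mats
open Matrix

abbrev M2 := Matrix (Fin 2) (Fin 2) ℂ

lemma trace_zero_aux {A B : M2} (h : A * B = -(B * A)) (hB : IsUnit B) : A.trace = 0 := by
  obtain ⟨u, rfl⟩ := hB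
  have h1 : A = -((u : M2) * A * (↑u⁻¹ : M2)) := by
    rw [← neg_mul, ← h, mul_assoc, Units.mul_inv, mul_one]
  have h2 : A.trace = -A.trace := by
    conv_lhs => rw [h1]
    rw [trace_neg, trace_mul_comm, ← mul_assoc, Units.inv_mul, one_mul]
  exact self_eq_neg.1 h2

lemma sq_scalar_aux {A B : M2} (h : A * B = -(B * A)) (hB : IsUnit B) :
    A * A = (-A.det) • (1 : M2) := by
  have ht := trace_zero_aux h hB
  rw [trace_fin_two] at ht
  have h1 : A 1 1 = -A 0 0 := by linear_combination ht
  ext i j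
  fin_cases i <;> fin_cases j <;> simp [Matrix.mul_apply, Fin.sum_univ_two, det_fin_two, h1] <;> ring

lemma comm_scalar_aux {Q A B : M2} (h : A * B = -(B * A)) (hA : IsUnit A) (hB : IsUnit B)
    (hQA : Q * A = A * Q) (hQB : Q * B = B * Q) : ∃ c : ℂ, Q = c • (1 : M2) := by
  have ht := trace_zero_aux h hB
  rw [trace_fin_two] at ht
  have h1 : A 1 1 = -A 0 0 := by linear_combination ht
  have hdet : A.det ≠ 0 := ((Matrix.isUnit_iff_isUnit_det _).1 hA).ne_zero
  -- `Q` is a combination of `1` and `A`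
  have hspan : ∃ x y : ℂ, Q = x • (1 : M2) + y • A := by
    have e00 := congrFun (congrFun hQA 0) 0
    have e01 := congrFun (congrFun hQA 0) 1
    have e10 := congrFun (congrFun hQA 1) 0
    simp only [Matrix.mul_apply, Fin.sum_univ_two, h1] at e00 e01 e10
    by_cases hq : A 0 1 = 0
    · by_cases hr : A 1 0 = 0
      · have hp : A 0 0 ≠ 0 := by
          intro hp; apply hdet; rw [det_fin_two, h1, hp, hq]; ring
        refine ⟨(Q 0 0 + Q 1 1) / 2, (Q 0 0 - Q 1 1) / (2 * A 0 0), ?_⟩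
        have q01 : Q 0 1 = 0 := by
          have : 2 * A 0 0 * Q 0 1 = 0 := by linear_combination -e01 + (Q 0 0 - Q 1 1) * hq
          simpa [hp] using this
        have q10 : Q 1 0 = 0 := by
          have : 2 * A 0 0 * Q 1 0 = 0 := by linear_combination e10 + (Q 0 0 - Q 1 1) * hr
          simpa [hp] using this
        ext i j
        fin_cases i <;> fin_cases j <;> simp [h1, hq, hr, q01, q10] <;>
          field_simp <;> ring
      · refine ⟨Q 0 0 - Q 1 0 / A 1 0 * A 0 0, Q 1 0 / A 1 0, ?_⟩
        ext i j
        fin_cases i <;> fin_cases j <;> simp [h1] <;> field_simp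
        · linear_combination e00
        · linear_combination e10
    · refine ⟨Q 0 0 - Q 0 1 / A 0 1 * A 0 0, Q 0 1 / A 0 1, ?_⟩
      ext i j
      fin_cases i <;> fin_cases j <;> simp [h1] <;> field_simp
      · linear_combination -e00
      · linear_combination -e01
  obtain ⟨x, y, rfl⟩ := hspan
  have h2 : y • (A * B) = y • (B * A) := by
    simpa [add_mul, mul_add] using hQB
  rw [h, smul_neg] at h2
  have h3 : y • (B * A) = 0 := by
    have h5 : (2 : ℂ) • (y • (B * A)) = 0 := by
      rw [two_smul]
      nth_rewrite 1 [← h2]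
      exact neg_add_cancel _
    exact (smul_eq_zero.1 h5).resolve_left two_ne_zero
  have h4 : y = 0 := by
    rcases smul_eq_zero.1 h3 with h | h
    · exact h
    · exact absurd h (hB.mul hA).ne_zero
  exact ⟨x, by simp [h4]⟩

lemma prod_scalar_aux {T₁ T₂ T₃ : M2} (h2 : IsUnit T₂) (h3 : IsUnit T₃)
    (h₁₂ : T₁ * T₂ = -(T₂ * T₁)) (h₁₃ : T₁ * T₃ = -(T₃ * T₁)) (h₂₃ : T₂ * T₃ = -(T₃ * T₂)) :
    ∃ c : ℂ, T₁ = c • (T₂ * T₃) := by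
  have h23 : (T₂ * T₃) * (T₂ * T₃) = -(T₂ * T₂) * (T₃ * T₃) := by
    calc (T₂ * T₃) * (T₂ * T₃) = T₂ * (T₃ * T₂) * T₃ := by noncomm_ring
      _ = T₂ * -(T₂ * T₃) * T₃ := by rw [h₂₃, neg_neg]
      _ = _ := by noncomm_ring
  have h32 : T₃ * T₂ = -(T₂ * T₃) := by rw [h₂₃, neg_neg]
  have e1 : (T₁ * (T₂ * T₃)) * T₂ = T₂ * (T₁ * (T₂ * T₃)) := by
    calc (T₁ * (T₂ * T₃)) * T₂ = (T₁ * T₂) * (T₃ * T₂) := by noncomm_ring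
      _ = _ := by rw [h₁₂, h32]; noncomm_ring
  have e2 : (T₁ * (T₂ * T₃)) * T₃ = T₃ * (T₁ * (T₂ * T₃)) := by
    calc (T₁ * (T₂ * T₃)) * T₃ = T₁ * (T₂ * T₃) * T₃ := by noncomm_ring
      _ = T₁ * -(T₃ * T₂) * T₃ := by rw [h₂₃]
      _ = -((T₁ * T₃) * (T₂ * T₃)) := by noncomm_ring
      _ = _ := by rw [h₁₃]; noncomm_ring
  obtain ⟨q, hq⟩ := comm_scalar_aux h₂₃ h2 h3 e1 e2
  have s2 := sq_scalar_aux h₂₃ h3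
  have s3 := sq_scalar_aux h32 h2
  have d2 : T₂.det ≠ 0 := ((Matrix.isUnit_iff_isUnit_det _).1 h2).ne_zero
  have d3 : T₃.det ≠ 0 := ((Matrix.isUnit_iff_isUnit_det _).1 h3).ne_zero
  refine ⟨-(q / (T₂.det * T₃.det)), ?_⟩
  have h5 : T₁ * (T₂ * T₃) * (T₂ * T₃) = -(T₂.det * T₃.det) • T₁ := by
    rw [mul_assoc, h23, s2, s3]
    simp [smul_smul]
    ring_nf
  rw [hq, smul_mul_assoc, one_mul] at h5
  rw [neg_smul, div_eq_inv_mul, ← smul_smul, h5, smul_smul]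
  field_simp
  simp

open scoped ComplexOrder MatrixOrder Matrix.Norms.L2Operator in
lemma rank_one_aux (A : M2) (hA : opNorm2 A = 1) :
    ∃ d : Fin 2 → ℂ, 1 - A * Aᴴ = vecMulVec d (star d) := by
  have hn : ‖A‖ = 1 := hA
  have hAA : ‖A * star A‖ = 1 := by rw [CStarRing.norm_self_mul_star, hn, one_mul]
  have hnn : 0 ≤ A * star A := mul_star_self_nonneg A
  have hle : A * star A ≤ 1 := (CStarAlgebra.norm_le_one_iff_of_nonneg _ hnn).1 hAA.le
  have hps : (1 - A * star A).PosSemidef := Matrix.nonneg_iff_posSemidef.1 (sub_nonneg.2 hle)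
  have hsp := CStarAlgebra.norm_mem_spectrum_of_nonneg hnn
  rw [hAA, spectrum.mem_iff, map_one, Matrix.isUnit_iff_isUnit_det, isUnit_iff_ne_zero, not_not]
    at hsp
  rw [← star_eq_conjTranspose]
  set Q : M2 := 1 - A * star A with hQ
  have hh := hps.isHermitian
  have h01 : star (Q 1 0) = Q 0 1 := hh.apply 0 1
  have p0 : 0 ≤ Q 0 0 := hps.diag_nonneg
  have p1 : 0 ≤ Q 1 1 := hps.diag_nonneg
  obtain ⟨x, hx, hx'⟩ := RCLike.nonneg_iff_exists_ofReal.1 p0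
  obtain ⟨y, hy, hy'⟩ := RCLike.nonneg_iff_exists_ofReal.1 p1
  rw [det_fin_two] at hsp
  have hcon : conj (Q 1 0) = Q 0 1 := h01
  have hcon' : conj (Q 0 1) = Q 1 0 := by rw [← hcon, Complex.conj_conj]
  rcases hx.eq_or_lt with h | h
  · have h00 : Q 0 0 = 0 := by rw [← hx', ← h]; simp
    have hz : Q 0 1 = 0 := by
      rw [h00, zero_mul, zero_sub, neg_eq_zero, ← hcon', mul_eq_zero] at hsp
      rcases hsp with h | h
      · exact h
      · simpa using h
    have hz' : Q 1 0 = 0 := by rw [← hcon', hz]; simp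
    refine ⟨![0, (Real.sqrt y : ℂ)], ?_⟩
    have hs : (Real.sqrt y : ℂ) * Real.sqrt y = y := by exact_mod_cast Real.mul_self_sqrt hy
    ext i j
    fin_cases i <;> fin_cases j <;> simp [vecMulVec_apply, h00, hz, hz', hs]
    exact hy'.symm
  · have hs : (Real.sqrt x : ℂ) * Real.sqrt x = x := by exact_mod_cast Real.mul_self_sqrt hx
    have hs0 : (Real.sqrt x : ℂ) ≠ 0 := by
      exact_mod_cast (Real.sqrt_pos.2 h).ne'
    have hx0 : (x : ℂ) ≠ 0 := by exact_mod_cast h.ne'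
    have hx'' : Q 0 0 = (x : ℂ) := hx'.symm
    refine ⟨![(Real.sqrt x : ℂ), Q 1 0 / Real.sqrt x], ?_⟩
    ext i j
    fin_cases i <;> fin_cases j <;> simp [vecMulVec_apply, hs, hcon, hx'']
    · field_simp
    · field_simp
    · field_simp
      rw [hx''] at hsp
      rw [pow_two, hs]
      linear_combination hsp

lemma unitary_factor_aux (X Y : M2) (h : X * Xᴴ = Y * Yᴴ) :
    ∃ N : M2, N * Nᴴ = 1 ∧ X = Y * N := by
  let tc := Matrix.toEuclideanCLM (n := Fin 2) (𝕜 := ℂ)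
  let F : E2 →ₗ[ℂ] E2 := (tc Xᴴ : E2 →L[ℂ] E2)
  let G : E2 →ₗ[ℂ] E2 := (tc Yᴴ : E2 →L[ℂ] E2)
  have hnorm : ∀ Z : M2, ∀ x : E2, ((‖tc Zᴴ x‖ : ℂ)) ^ 2 = ⟪x, tc (Z * Zᴴ) x⟫_ℂ := by
    intro Z x
    have h1 : tc Zᴴ = star (tc Z) := map_star tc Z
    rw [map_mul, ContinuousLinearMap.mul_apply]
    have h2 : ⟪tc Zᴴ x, tc Zᴴ x⟫_ℂ = ⟪x, tc Z (tc Zᴴ x)⟫_ℂ := by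
      conv_lhs => rw [inner_star, h1, star_star, ← h1]
    rw [← h2, inner_self_eq_norm_sq_to_K]
    rfl
  have hFG : ∀ x, ‖F x‖ = ‖G x‖ := by
    intro x
    have h1 := hnorm X x
    rw [h, ← hnorm Y x] at h1
    have h2 : ‖tc Xᴴ x‖ ^ 2 = ‖tc Yᴴ x‖ ^ 2 := by exact_mod_cast h1
    exact (pow_left_inj₀ (norm_nonneg _) (norm_nonneg _) two_ne_zero).1 h2
  obtain ⟨s, hs⟩ := G.rangeRestrict.exists_rightInverse_of_surjective (LinearMap.range_rangeRestrict G)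
  have hs' : ∀ y : LinearMap.range G, G (s y) = y := fun y =>
    congrArg Subtype.val (LinearMap.congr_fun hs y)
  let L : LinearMap.range G →ₗᵢ[ℂ] E2 := ⟨F ∘ₗ s, fun y => by
    rw [LinearMap.comp_apply, hFG, hs']; rfl⟩
  have hL : ∀ x, L.extend (G x) = F x := by
    intro x
    have h1 := L.extend_apply ⟨G x, LinearMap.mem_range_self G x⟩
    rw [h1]
    change F (s ⟨G x, _⟩) = F x
    rw [← sub_eq_zero, ← map_sub, ← norm_eq_zero, hFG, map_sub, hs', sub_self, norm_zero]
  obtain ⟨N, hN⟩ := tc.surjective L.extend.toContinuousLinearMap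
  refine ⟨Nᴴ, ?_, ?_⟩
  · rw [conjTranspose_conjTranspose]
    apply tc.injective
    have h1 : tc Nᴴ = star (tc N) := map_star tc N
    have h2 : tc (Nᴴ * N) = star (tc N) * tc N := by rw [← h1]; exact map_mul tc _ _
    refine h2.trans (Eq.trans ?_ (map_one tc).symm)
    ext1 x
    refine ext_inner_left ℂ fun y => ?_
    rw [ContinuousLinearMap.mul_apply, ← inner_star, show tc N = _ from hN]
    exact L.extend.inner_map_map y x
  · have h1 : Xᴴ = N * Yᴴ := by
      apply tc.injective
      rw [map_mul, hN]
      ext1 x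
      exact (hL x).symm
    rw [← conjTranspose_conjTranspose X, h1, conjTranspose_mul, conjTranspose_conjTranspose]

end mats

section cases
open Matrix

/-- The operator on `ℂ²` given by a matrix. -/
noncomputable abbrev tc (A : M2) : E2 →L[ℂ] E2 := Matrix.toEuclideanCLM (n := Fin 2) (𝕜 := ℂ) A

lemma tc_mul (A B : M2) : tc (A * B) = tc A * tc B := map_mul _ A B
lemma tc_one : tc 1 = 1 := map_one _
lemma tc_smul (c : ℂ) (A : M2) : tc (c • A) = c • tc A := map_smul _ c A
lemma tc_neg (A : M2) : tc (-A) = -tc A := map_neg _ A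
lemma tc_sub (A B : M2) : tc (A - B) = tc A - tc B := map_sub _ A B
lemma tc_pow (A : M2) (n : ℕ) : tc (A ^ n) = tc A ^ n := map_pow _ A n
lemma tc_star (A : M2) : tc (Aᴴ) = star (tc A) := map_star _ A
lemma tc_toLp (A : M2) (v : Fin 2 → ℂ) : tc A (WithLp.toLp 2 v) = WithLp.toLp 2 (A *ᵥ v) := rfl

lemma tc_rank {A : M2} {d : Fin 2 → ℂ} (h : 1 - A * Aᴴ = vecMulVec d (star d)) (x : E2) :
    x - tc A (star (tc A) x) = ⟪(WithLp.toLp 2 d : E2), x⟫_ℂ • (WithLp.toLp 2 d : E2) := by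
  have h1 : x - tc A (star (tc A) x) = tc (1 - A * Aᴴ) x := by
    rw [tc_sub, tc_mul, tc_star, tc_one]; rfl
  rw [h1, h]
  obtain ⟨v, rfl⟩ : ∃ v : Fin 2 → ℂ, x = WithLp.toLp 2 v := ⟨x.ofLp, rfl⟩
  rw [tc_toLp]
  ext i
  simp [mulVec, dotProduct, vecMulVec_apply, Fin.sum_univ_two, PiLp.inner_apply]
  ring

lemma factor_aux {A B : M2} (hAB : A * B = -(B * A)) {d f : Fin 2 → ℂ}
    (hd : 1 - A * Aᴴ = vecMulVec d (star d)) (hf : 1 - B * Bᴴ = vecMulVec f (star f)) :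
    ∃ α β γ δ : ℂ, B *ᵥ d = α • d + β • (A *ᵥ f) ∧ f = γ • d + δ • (A *ᵥ f) ∧
      ‖α * δ - β * γ‖ = 1 ∧ α = (α * δ - β * γ) * conj δ ∧ ‖δ‖ ≤ 1 := by
  have key : ∀ u v : Fin 2 → ℂ, !![u 0, v 0; u 1, v 1] * !![u 0, v 0; u 1, v 1]ᴴ =
      vecMulVec u (star u) + vecMulVec v (star v) := by
    intro u v
    ext i j
    fin_cases i <;> fin_cases j <;>
      simp [Matrix.mul_apply, Fin.sum_univ_two, vecMulVec_apply]
  have key2 : ∀ (C : M2) (u : Fin 2 → ℂ), vecMulVec (C *ᵥ u) (star (C *ᵥ u)) =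
      C * vecMulVec u (star u) * Cᴴ := by
    intro C u
    rw [star_mulVec, mul_vecMulVec, vecMulVec_mul]
  obtain ⟨N, hN, hX⟩ := unitary_factor_aux
    !![(B *ᵥ d) 0, f 0; (B *ᵥ d) 1, f 1] !![d 0, (A *ᵥ f) 0; d 1, (A *ᵥ f) 1] (by
      rw [key, key, key2, key2, ← hd, ← hf]
      have h1 : (A * B) * (A * B)ᴴ = (B * A) * (B * A)ᴴ := by rw [hAB]; simp
      rw [conjTranspose_mul, conjTranspose_mul] at h1
      have h2 : B * (1 - A * Aᴴ) * Bᴴ + (1 - B * Bᴴ) = 1 - B * A * (Aᴴ * Bᴴ) := by noncomm_ring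
      have h3 : 1 - A * Aᴴ + A * (1 - B * Bᴴ) * Aᴴ = 1 - A * B * (Bᴴ * Aᴴ) := by noncomm_ring
      rw [h2, h3, h1])
  have x00 := congrFun (congrFun hX 0) 0
  have x01 := congrFun (congrFun hX 0) 1
  have x10 := congrFun (congrFun hX 1) 0
  have x11 := congrFun (congrFun hX 1) 1
  rw [Matrix.mul_apply, Fin.sum_univ_two] at x00 x01 x10 x11
  have n00 := congrFun (congrFun hN 0) 0
  have n01 := congrFun (congrFun hN 0) 1
  have n10 := congrFun (congrFun hN 1) 0
  have n11 := congrFun (congrFun hN 1) 1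
  rw [Matrix.mul_apply, Fin.sum_univ_two] at n00 n01 n10 n11
  have hdet : N.det * star N.det = 1 := by
    rw [← det_conjTranspose, ← det_mul, hN, det_one]
  refine ⟨N 0 0, N 1 0, N 0 1, N 1 1, ?_, ?_, ?_, ?_, ?_⟩
  · ext i; fin_cases i
    · simp at x00 ⊢; rw [x00]; ring
    · simp at x10 ⊢; rw [x10]; ring
  · ext i; fin_cases i
    · simp at x01 ⊢; linear_combination x01
    · simp at x11 ⊢; linear_combination x11
  · have h1 : N 0 0 * N 1 1 - N 1 0 * N 0 1 = N.det := by rw [det_fin_two]; ring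
    rw [h1]
    have h2 : ‖N.det‖ * ‖N.det‖ = 1 := by
      simpa using congrArg norm hdet
    nlinarith [norm_nonneg N.det]
  · simp at n00 n01 n10 n11
    linear_combination N 1 0 * n01 - N 0 0 * n11
  · simp at n11
    rw [Complex.mul_conj, Complex.mul_conj] at n11
    have h1 : Complex.normSq (N 1 0) + Complex.normSq (N 1 1) = 1 := by exact_mod_cast n11
    rw [Complex.normSq_eq_norm_sq, Complex.normSq_eq_norm_sq] at h1
    nlinarith [norm_nonneg (N 1 1), sq_nonneg ‖N 1 0‖]

lemma pure_case {A B : M2} (hAB : A * B = -(B * A)) (hB : IsUnit B) {d f : Fin 2 → ℂ}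
    (hd : 1 - A * Aᴴ = vecMulVec d (star d)) (hf : 1 - B * Bᴴ = vecMulVec f (star f))
    (hd0 : d ≠ 0) : PairModel (tc A) (tc B) := by
  obtain ⟨α, β, γ, δ, e1, e2, e3, e4, e5⟩ := factor_aux hAB hd hf
  have hsq := sq_scalar_aux hAB hB
  generalize -A.det = a at hsq
  have hAA : tc A * tc A = a • (1 : E2 →L[ℂ] E2) := by rw [← tc_mul, hsq, tc_smul, tc_one]
  have hAA' : ∀ x, tc A (tc A x) = a • x := fun x => by
    rw [← ContinuousLinearMap.mul_apply, hAA]; rfl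
  have hSS : ∀ x, star (tc A) (star (tc A) x) = conj a • x := fun x => by
    rw [← ContinuousLinearMap.mul_apply, ← star_mul, hAA, star_smul, star_one]; rfl
  have hr := tc_rank hd
  set D : E2 := WithLp.toLp 2 d with hD
  set F : E2 := WithLp.toLp 2 f with hF
  have hD0 : D ≠ 0 := by
    intro h; apply hd0
    exact congrArg WithLp.ofLp h
  have hdd : ∀ x : E2, ⟪D, x⟫_ℂ • D + ⟪tc A D, x⟫_ℂ • tc A D = (1 - conj a * a) • x := by
    intro x
    have h1 := hr x
    have h2 := congrArg (tc A) (hr (star (tc A) x))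
    rw [map_sub, map_smul, hAA', hSS, ← inner_star] at h2
    rw [← h1, ← h2, smul_smul, sub_smul, one_smul, mul_comm]
    abel
  have ha : ‖a‖ < 1 := by
    have h2 : ⟪D, ⟪D, D⟫_ℂ • D + ⟪tc A D, D⟫_ℂ • tc A D⟫_ℂ =
        (((‖D‖ ^ 2) ^ 2 + ‖⟪D, tc A D⟫_ℂ‖ ^ 2 : ℝ) : ℂ) := by
      rw [inner_add_right, inner_smul_right, inner_smul_right, inner_self_eq_norm_sq_to_K,
        ← inner_conj_symm (tc A D) D, Complex.conj_mul']
      push_cast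
      simp only [Complex.coe_algebraMap]
      ring
    have h3 : ⟪D, (1 - conj a * a) • D⟫_ℂ = (((1 - ‖a‖ ^ 2) * ‖D‖ ^ 2 : ℝ) : ℂ) := by
      rw [inner_smul_right, inner_self_eq_norm_sq_to_K, Complex.conj_mul']
      push_cast; rfl
    rw [hdd, h3] at h2
    have h4 : (1 - ‖a‖ ^ 2) * ‖D‖ ^ 2 = (‖D‖ ^ 2) ^ 2 + ‖⟪D, tc A D⟫_ℂ‖ ^ 2 := by exact_mod_cast h2
    have h5 : 0 < ‖D‖ ^ 2 := by have := norm_pos_iff.2 hD0; positivity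
    have h6 : 0 < (1 - ‖a‖ ^ 2) * ‖D‖ ^ 2 := by rw [h4]; positivity
    have h7 : 0 < 1 - ‖a‖ ^ 2 := pos_of_mul_pos_left h6 h5.le
    nlinarith [norm_nonneg a]
  have E1 : tc B D = α • D + β • tc A F := by
    rw [hD, tc_toLp, e1]; rfl
  have E2' : F = γ • D + δ • tc A F := congrArg (WithLp.toLp 2) e2
  refine pure_model (tc A) (tc B) a (-conj δ) (-(α * δ - β * γ)) D ha hAA ?_ hdd ?_ ?_ ?_
  · rw [← tc_mul, hAB, tc_neg, tc_mul]
  · simpa using e5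
  · rw [norm_neg, e3]
  · have E3 : tc A F = γ • tc A D + (δ * a) • F := by
      conv_lhs => rw [E2']
      rw [map_add, map_smul, map_smul, hAA', smul_smul]
    rw [E1, map_add, map_smul, map_smul, hAA', map_neg, Complex.conj_conj]
    linear_combination (norm := module) β • E3 + e4 • D

end cases

section final
open Matrix

lemma unitary_case {A B : M2} (hAB : A * B = -(B * A)) (hA1 : A * Aᴴ = 1) (hB1 : B * Bᴴ = 1) :
    PairModel (tc A) (tc B) := by
  have hAu : tc A ∈ unitary (E2 →L[ℂ] E2) := by
    rw [Unitary.mem_iff, ← tc_star, ← tc_mul, ← tc_mul, hA1, mul_eq_one_comm.1 hA1, tc_one]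
    exact ⟨rfl, rfl⟩
  have hBu : tc B ∈ unitary (E2 →L[ℂ] E2) := by
    rw [Unitary.mem_iff, ← tc_star, ← tc_mul, ← tc_mul, hB1, mul_eq_one_comm.1 hB1, tc_one]
    exact ⟨rfl, rfl⟩
  have hBA : B * A = -(A * B) := by rw [hAB, neg_neg]
  have hAun : IsUnit A := IsUnit.of_mul_eq_one _ hA1
  have hBun : IsUnit B := IsUnit.of_mul_eq_one _ hB1
  have key : ∀ C : M2, C * Cᴴ = 1 → (∃ c : ℂ, C * C = c • (1 : M2)) →
      ∃ γ : ℂ, ‖γ‖ = 1 ∧ ∀ x, tc C (tc C x) = (γ * γ) • x := by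
    rintro C hC ⟨c, hc⟩
    obtain ⟨γ, hγ⟩ := IsAlgClosed.exists_pow_nat_eq c (n := 2) two_pos
    have hCC : ∀ x, tc C (tc C x) = (γ * γ) • x := fun x => by
      rw [← ContinuousLinearMap.mul_apply, ← tc_mul, hc, ← hγ, tc_smul, tc_one, pow_two]; rfl
    refine ⟨γ, ?_, hCC⟩
    have hCu : tc C ∈ unitary (E2 →L[ℂ] E2) := by
      rw [Unitary.mem_iff, ← tc_star, ← tc_mul, ← tc_mul, hC, mul_eq_one_comm.1 hC, tc_one]
      exact ⟨rfl, rfl⟩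
    obtain ⟨x, hx⟩ := exists_ne (0 : E2)
    have h1 := congrArg norm (hCC x)
    rw [ContinuousLinearMap.norm_map_of_mem_unitary hCu,
      ContinuousLinearMap.norm_map_of_mem_unitary hCu, norm_smul, norm_mul] at h1
    have h2 : ‖γ‖ * ‖γ‖ = 1 := by
      have := norm_ne_zero_iff.2 hx
      field_simp at h1
      nlinarith
    nlinarith [norm_nonneg γ]
  obtain ⟨α, hα, hAA⟩ := key A hA1 ⟨_, sq_scalar_aux hAB hBun⟩
  obtain ⟨β, hβ, hBB⟩ := key B hB1 ⟨_, sq_scalar_aux hBA hAun⟩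
  have hα0 : α ≠ 0 := by intro h; simp [h] at hα
  have hβ0 : β ≠ 0 := by intro h; simp [h] at hβ
  have hABx : ∀ x, tc A (tc B x) = -tc B (tc A x) := fun x => by
    rw [← ContinuousLinearMap.mul_apply, ← ContinuousLinearMap.mul_apply, ← tc_mul, hAB, tc_neg,
      tc_mul]; rfl
  have hex : ∃ v : E2, v ≠ 0 ∧ tc A v = α • v := by
    obtain ⟨x, hx⟩ := exists_ne (0 : E2)
    by_cases h : tc A x + α • x = 0
    · have h1 : tc A x = -(α • x) := eq_neg_of_add_eq_zero_left h
      refine ⟨tc B x, ?_, ?_⟩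
      · rw [← norm_ne_zero_iff, ContinuousLinearMap.norm_map_of_mem_unitary hBu]
        exact norm_ne_zero_iff.2 hx
      · rw [hABx, h1, map_neg, neg_neg, map_smul]
    · refine ⟨_, h, ?_⟩
      rw [map_add, map_smul, hAA, smul_add, smul_smul, add_comm]
  obtain ⟨v0, hv0, hAv0⟩ := hex
  have hn0 : ‖v0‖ ≠ 0 := norm_ne_zero_iff.2 hv0
  set v : E2 := ((‖v0‖⁻¹ : ℝ) : ℂ) • v0 with hv
  have hvn : ‖v‖ = 1 := by
    rw [hv, norm_smul]; simp [hn0]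
  have hAv : tc A v = α • v := by rw [hv, map_smul, hAv0, smul_comm]
  set v' : E2 := β⁻¹ • tc B v with hv'
  have hvn' : ‖v'‖ = 1 := by
    rw [hv', norm_smul, ContinuousLinearMap.norm_map_of_mem_unitary hBu, norm_inv, hβ, hvn]; simp
  have hAv' : tc A v' = -(α • v') := by
    rw [hv', map_smul, hABx, hAv, map_smul, smul_neg, smul_comm]
  have hBv : tc B v = β • v' := by rw [hv', smul_smul, mul_inv_cancel₀ hβ0, one_smul]
  have hBv' : tc B v' = β • v := by
    rw [hv', map_smul, hBB, smul_smul, ← mul_assoc, inv_mul_cancel₀ hβ0, one_mul]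
  have horth : ⟪v, v'⟫_ℂ = 0 := by
    have h1 := ContinuousLinearMap.inner_map_map_of_mem_unitary hAu v v'
    rw [hAv, hAv', inner_neg_right, inner_smul_left, inner_smul_right, ← mul_assoc,
      Complex.conj_mul', hα] at h1
    simp at h1
    exact self_eq_neg.1 h1.symm
  refine unitary_model (tc A) (tc B) α β hα hβ v v' hAv hAv' hBv hBv' ?_
  have hon : Orthonormal ℂ ![v, v'] := by
    rw [orthonormal_iff_ite]
    have h1 : ⟪v', v⟫_ℂ = 0 := by rw [← inner_conj_symm, horth]; simp
    intro i j
    fin_cases i <;> fin_cases j <;> simp [horth, h1, inner_self_eq_norm_sq_to_K, hvn, hvn']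
  let b := basisOfOrthonormalOfCardEqFinrank hon (by simp)
  have hb : (b : Fin 2 → E2) = ![v, v'] := coe_basisOfOrthonormalOfCardEqFinrank _ _
  let ob := b.toOrthonormalBasis (by rw [hb]; exact hon)
  have hob : (ob : Fin 2 → E2) = ![v, v'] := by
    rw [Module.Basis.coe_toOrthonormalBasis, hb]
  intro x
  have h1 := ob.sum_repr' x
  rw [hob, Fin.sum_univ_two] at h1
  exact h1

lemma pair_case {A B : M2} (hAB : A * B = -(B * A)) (hA : IsUnit A) (hB : IsUnit B)
    (hA1 : opNorm2 A = 1) (hB1 : opNorm2 B = 1) : PairModel (tc A) (tc B) := by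
  obtain ⟨d, hd⟩ := rank_one_aux A hA1
  obtain ⟨f, hf⟩ := rank_one_aux B hB1
  by_cases hd0 : d = 0
  · by_cases hf0 : f = 0
    · refine unitary_case hAB ?_ ?_
      · rw [hd0, zero_vecMulVec, sub_eq_zero] at hd; exact hd.symm
      · rw [hf0, zero_vecMulVec, sub_eq_zero] at hf; exact hf.symm
    · exact (pure_case (by rw [hAB, neg_neg]) hA hf hd hf0).symm
  · exact pure_case hAB hB hd hf hd0

lemma normalize_aux {T : M2} (hT : IsUnit T) (h1 : opNorm2 T ≤ 1) :
    ∃ (s : ℂ) (A : M2), s ≠ 0 ∧ ‖s‖ ≤ 1 ∧ IsUnit A ∧ opNorm2 A = 1 ∧ T = s • A ∧ A = s⁻¹ • T := by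
  have h0 : opNorm2 T ≠ 0 := by
    intro h
    apply hT.ne_zero
    have h2 : tc T = 0 := norm_eq_zero.1 h
    exact (Matrix.toEuclideanCLM (n := Fin 2) (𝕜 := ℂ)).injective (h2.trans (map_zero _).symm)
  have h0' : 0 ≤ opNorm2 T := norm_nonneg _
  have hs : (opNorm2 T : ℂ) ≠ 0 := by exact_mod_cast h0
  refine ⟨opNorm2 T, (opNorm2 T : ℂ)⁻¹ • T, hs, ?_, ?_, ?_, ?_, rfl⟩
  · rw [Complex.norm_real, Real.norm_of_nonneg h0']; exact h1
  · rw [Matrix.isUnit_iff_isUnit_det, det_smul, isUnit_iff_ne_zero]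
    exact mul_ne_zero (pow_ne_zero _ (inv_ne_zero hs))
      ((Matrix.isUnit_iff_isUnit_det _).1 hT).ne_zero
  · change ‖tc _‖ = 1
    rw [tc_smul, norm_smul, norm_inv, Complex.norm_real, Real.norm_of_nonneg h0']
    exact inv_mul_cancel₀ h0
  · rw [smul_smul, mul_inv_cancel₀ hs, one_smul]

end final

end helpers

/-- An anti-commuting triple of invertible contractions `(T₁, T₂, T₃)` on `ℂ²` with
`‖T₁‖ ≤ ‖T₂T₃‖` dilates to an anti-commuting triple of unitaries. -/
theorem stmt10 (T₁ T₂ T₃ : Matrix (Fin 2) (Fin 2) ℂ)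
    (hcontr₁ : opNorm2 T₁ ≤ 1) (hcontr₂ : opNorm2 T₂ ≤ 1) (hcontr₃ : opNorm2 T₃ ≤ 1)
    (hinv₁ : IsUnit T₁) (hinv₂ : IsUnit T₂) (hinv₃ : IsUnit T₃)
    (h₁₂ : T₁ * T₂ = -(T₂ * T₁)) (h₁₃ : T₁ * T₃ = -(T₃ * T₁)) (h₂₃ : T₂ * T₃ = -(T₃ * T₂))
    (hnorm : opNorm2 T₁ ≤ opNorm2 (T₂ * T₃)) :
    ∃ (K : Type) (_ : NormedAddCommGroup K) (_ : InnerProductSpace ℂ K) (_ : CompleteSpace K)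
      (U₁ U₂ U₃ : K →L[ℂ] K) (V : EuclideanSpace ℂ (Fin 2) →ₗᵢ[ℂ] K),
      U₁ ∈ unitary (K →L[ℂ] K) ∧ U₂ ∈ unitary (K →L[ℂ] K) ∧ U₃ ∈ unitary (K →L[ℂ] K) ∧
      U₁ * U₂ = -(U₂ * U₁) ∧ U₁ * U₃ = -(U₃ * U₁) ∧ U₂ * U₃ = -(U₃ * U₂) ∧
      (∀ m n r : ℕ,
        Matrix.toEuclideanCLM (𝕜 := ℂ) (T₁ ^ m * T₂ ^ n * T₃ ^ r) =
          (ContinuousLinearMap.adjoint V.toContinuousLinearMap) ∘L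
            (U₁ ^ m * U₂ ^ n * U₃ ^ r) ∘L V.toContinuousLinearMap) := by
  obtain ⟨s₂, A, hs₂, hs₂1, hA, hA1, hT₂, hA'⟩ := normalize_aux hinv₂ hcontr₂
  obtain ⟨s₃, B, hs₃, hs₃1, hB, hB1, hT₃, hB'⟩ := normalize_aux hinv₃ hcontr₃
  have hAB : A * B = -(B * A) := by
    rw [hA', hB', smul_mul_smul_comm, smul_mul_smul_comm, h₂₃, smul_neg, mul_comm s₂⁻¹]
  obtain ⟨c, hc⟩ := prod_scalar_aux hinv₂ hinv₃ h₁₂ h₁₃ h₂₃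
  have hc1 : ‖c‖ ≤ 1 := by
    have hpos : 0 < opNorm2 (T₂ * T₃) := by
      refine norm_pos_iff.2 fun h => (hinv₂.mul hinv₃).ne_zero ?_
      exact (Matrix.toEuclideanCLM (n := Fin 2) (𝕜 := ℂ)).injective (h.trans (map_zero _).symm)
    have h1 : opNorm2 T₁ = ‖c‖ * opNorm2 (T₂ * T₃) := by
      change ‖tc T₁‖ = ‖c‖ * ‖tc (T₂ * T₃)‖
      rw [hc, tc_smul, norm_smul]
    rw [h1] at hnorm
    exact le_of_mul_le_mul_right (by linarith) hpos
  have hT₁ : T₁ = (c * (s₂ * s₃)) • (A * B) := by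
    rw [hc, hT₂, hT₃, smul_mul_smul_comm, smul_smul]
  have hc2 : ‖c * (s₂ * s₃)‖ ≤ 1 := by
    rw [norm_mul, norm_mul]
    exact mul_le_one₀ hc1 (by positivity) (mul_le_one₀ hs₂1 (norm_nonneg _) hs₃1)
  obtain ⟨K, i1, i2, i3, U₁, U₂, U₃, V, a1, a2, a3, a4, a5, a6, a7⟩ :=
    (pair_case hAB hA hB hA1 hB1).dilate (c * (s₂ * s₃)) s₂ s₃ hc2 hs₂1 hs₃1
  refine ⟨K, i1, i2, i3, U₁, U₂, U₃, V, a1, a2, a3, a4, a5, a6, fun m n r => ?_⟩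
  rw [← a7 m n r]
  change tc (T₁ ^ m * T₂ ^ n * T₃ ^ r) = _
  rw [tc_mul, tc_mul, tc_pow, tc_pow, tc_pow, hT₁, hT₂, hT₃, tc_smul, tc_smul, tc_smul, tc_mul]
end

section
/- Let (T₁,T₂,T₃) be a triple of invertible 2×2 complex matrices satisfying T_iT_j = −T_jT_i for all 1 ≤ i < j ≤ 3. Then there exists a non-zero scalar α ∈ ℂ such that T₂T₃ = αT₁. -/
/-- If `A` is invertible and anti-commutes with `B`, then `B` has trace zero. -/
lemma trace_zero_of_anticomm (A B : Matrix (Fin 2) (Fin 2) ℂ) (hA : IsUnit A)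
    (h : A * B = -(B * A)) : B.trace = 0 := by
  obtain ⟨u, rfl⟩ := hA
  have h1 : (u : Matrix (Fin 2) (Fin 2) ℂ) * B * (↑u⁻¹ : Matrix (Fin 2) (Fin 2) ℂ) = -B := by
    rw [h, neg_mul, mul_assoc, Units.mul_inv, mul_one]
  have h2 := congrArg Matrix.trace h1
  rw [Matrix.trace_mul_comm, ← mul_assoc, Units.inv_mul, one_mul, Matrix.trace_neg] at h2
  exact self_eq_neg.mp h2

/-- Commuting traceless `2 × 2` matrices are proportional. -/
lemma proportional_of_commute (A S : Matrix (Fin 2) (Fin 2) ℂ) (hA : A ≠ 0)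
    (tA : A.trace = 0) (tS : S.trace = 0) (h : A * S = S * A) : ∃ α : ℂ, S = α • A := by
  rw [Matrix.trace_fin_two] at tA tS
  have e00 := congrFun (congrFun h 0) 0
  have e01 := congrFun (congrFun h 0) 1
  have e10 := congrFun (congrFun h 1) 0
  simp only [Matrix.mul_apply, Fin.sum_univ_two] at e00 e01 e10
  have a11 : A 1 1 = -A 0 0 := by linear_combination tA
  have s11 : S 1 1 = -S 0 0 := by linear_combination tS
  rw [a11, s11] at e01 e10
  have k1 : A 0 0 * S 0 1 = S 0 0 * A 0 1 := by linear_combination e01 / 2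
  have k2 : A 0 0 * S 1 0 = S 0 0 * A 1 0 := by linear_combination -e10 / 2
  have k3 : A 0 1 * S 1 0 = S 0 1 * A 1 0 := by linear_combination e00
  by_cases h0 : A 0 0 = 0
  · by_cases h1 : A 0 1 = 0
    · have h2 : A 1 0 ≠ 0 := by
        intro h2
        apply hA
        ext i j
        fin_cases i <;> fin_cases j <;> simp [h0, h1, h2, a11]
      refine ⟨S 1 0 / A 1 0, ?_⟩
      ext i j
      fin_cases i <;> fin_cases j <;> simp [a11, s11] <;> field_simp <;> grind
    · refine ⟨S 0 1 / A 0 1, ?_⟩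
      ext i j
      fin_cases i <;> fin_cases j <;> simp [a11, s11] <;> field_simp <;> grind
  · refine ⟨S 0 0 / A 0 0, ?_⟩
    ext i j
    fin_cases i <;> fin_cases j <;> simp [a11, s11] <;> field_simp <;> grind

/-- For an anti-commuting triple `(T₁, T₂, T₃)` of invertible `2 × 2` complex matrices there is
a non-zero scalar `α` with `T₂T₃ = αT₁`. -/
theorem stmt18 (T₁ T₂ T₃ : Matrix (Fin 2) (Fin 2) ℂ)
    (hinv₁ : IsUnit T₁) (hinv₂ : IsUnit T₂) (hinv₃ : IsUnit T₃)
    (h₁₂ : T₁ * T₂ = -(T₂ * T₁)) (h₁₃ : T₁ * T₃ = -(T₃ * T₁)) (h₂₃ : T₂ * T₃ = -(T₃ * T₂)) :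
    ∃ α : ℂ, α ≠ 0 ∧ T₂ * T₃ = α • T₁ := by
  have t1 : T₁.trace = 0 :=
    trace_zero_of_anticomm T₂ T₁ hinv₂ (by rw [h₁₂, neg_neg])
  have tS : (T₂ * T₃).trace = 0 := by
    have h := congrArg Matrix.trace h₂₃
    rw [Matrix.trace_neg, Matrix.trace_mul_comm T₃ T₂] at h
    exact self_eq_neg.mp h
  have hc : T₁ * (T₂ * T₃) = T₂ * T₃ * T₁ := by
    rw [← mul_assoc, h₁₂, neg_mul, mul_assoc, h₁₃, mul_neg, neg_neg, mul_assoc]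
  obtain ⟨α, hα⟩ := proportional_of_commute T₁ (T₂ * T₃) hinv₁.ne_zero t1 tS hc
  refine ⟨α, ?_, hα⟩
  rintro rfl
  rw [zero_smul] at hα
  exact (hinv₂.mul hinv₃).ne_zero hα
end

section
/- Let T₁,…,T_k be non-zero 2×2 complex matrices satisfying T_iT_j = −T_jT_i for all 1 ≤ i < j ≤ k, and suppose T₁ is nilpotent. Then there is at most one index m ∈ {1,…,k} such that T_m is not a scalar multiple of T₁; in other words, all the matrices T_j except possibly one are non-zero scalar multiples of T₁. -/
theorem stmt19_key (N A B : Matrix (Fin 2) (Fin 2) ℂ) (hN : N ≠ 0) (h2 : N ^ 2 = 0)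
    (hA : N * A = -(A * N)) (hB : N * B = -(B * N)) (hAB : A * B = -(B * A)) :
    (∃ w : ℂ, A = w • N) ∨ (∃ w : ℂ, B = w • N) := by
  obtain ⟨x, y, z, u, rfl⟩ : ∃ x y z u, N = !![x, y; z, u] := ⟨_, _, _, _, Matrix.eta_fin_two N⟩
  obtain ⟨a, b, c, d, rfl⟩ : ∃ x y z u, A = !![x, y; z, u] := ⟨_, _, _, _, Matrix.eta_fin_two A⟩
  obtain ⟨a', b', c', d', rfl⟩ : ∃ x y z u, B = !![x, y; z, u] :=
    ⟨_, _, _, _, Matrix.eta_fin_two B⟩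
  have e : ∀ (P Q : Matrix (Fin 2) (Fin 2) ℂ), P = Q →
      P 0 0 = Q 0 0 ∧ P 0 1 = Q 0 1 ∧ P 1 0 = Q 1 0 ∧ P 1 1 = Q 1 1 := by
    rintro P Q rfl; simp
  have h2 := e _ _ h2
  have hA := e _ _ hA
  have hB := e _ _ hB
  have hAB := e _ _ hAB
  simp [pow_two, Matrix.mul_apply, Fin.sum_univ_two] at h2 hA hB hAB
  obtain ⟨n1, n2, n3, n4⟩ := h2
  obtain ⟨a1, a2, a3, a4⟩ := hA
  obtain ⟨b1, b2, b3, b4⟩ := hB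
  obtain ⟨c1, -, -, -⟩ := hAB
  by_cases hy : y = 0
  · subst hy
    have hx : x = 0 := by simpa using n1
    have hu : u = 0 := by simpa using n4
    subst hx hu
    have hz : z ≠ 0 := by
      rintro rfl
      exact hN (by ext i j; fin_cases i <;> fin_cases j <;> rfl)
    have hb : b = 0 := by simpa [hz] using a1
    have hb' : b' = 0 := by simpa [hz] using b1
    subst hb hb'
    have hd : d = -a := mul_left_cancel₀ hz (by linear_combination -a3 + 2 * a3)
    have hd' : d' = -a' := mul_left_cancel₀ hz (by linear_combination b3)
    have haa : a * a' = 0 := by linear_combination c1 / 2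
    rcases mul_eq_zero.1 haa with h | h
    · left; refine ⟨c / z, ?_⟩
      subst h hd
      ext i j; fin_cases i <;> fin_cases j <;> simp [hz]
    · right; refine ⟨c' / z, ?_⟩
      subst h hd'
      ext i j; fin_cases i <;> fin_cases j <;> simp [hz]
  · obtain ⟨t, rfl⟩ : ∃ t, x = y * t := ⟨x / y, by field_simp⟩
    have hu : u = -(y * t) := mul_left_cancel₀ hy (by linear_combination n2)
    subst hu
    have hz : z = -(y * t ^ 2) := mul_left_cancel₀ hy (by linear_combination n1)
    subst hz
    have hd : d = -a := mul_left_cancel₀ hy (by linear_combination a2)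
    have hd' : d' = -a' := mul_left_cancel₀ hy (by linear_combination b2)
    have hc : c = b * t ^ 2 - 2 * t * a := mul_left_cancel₀ hy (by linear_combination a1)
    have hc' : c' = b' * t ^ 2 - 2 * t * a' := mul_left_cancel₀ hy (by linear_combination b1)
    subst hd hd' hc hc'
    have haa : (a - b * t) * (a' - b' * t) = 0 := by linear_combination c1 / 2
    rcases mul_eq_zero.1 haa with h | h
    · left; refine ⟨b / y, ?_⟩
      obtain rfl := sub_eq_zero.1 h
      ext i j; fin_cases i <;> fin_cases j <;> simp <;> field_simp <;> ring
    · right; refine ⟨b' / y, ?_⟩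
      obtain rfl := sub_eq_zero.1 h
      ext i j; fin_cases i <;> fin_cases j <;> simp <;> field_simp <;> ring


/-- If `(T₁, …, T_k)` is an anti-commuting tuple of non-zero `2 × 2` complex matrices and `T₁`
is nilpotent, then all the matrices `T_j`, except possibly one, are non-zero scalar multiples
of `T₁`. -/
theorem stmt19 (k : ℕ) (hk : 0 < k) (T : Fin k → Matrix (Fin 2) (Fin 2) ℂ)
    (hnz : ∀ i, T i ≠ 0)
    (hanti : ∀ i j : Fin k, i < j → T i * T j = -(T j * T i))
    (hnil : (T ⟨0, hk⟩) ^ 2 = 0) :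
    ∃ m : Fin k, ∀ j : Fin k, j ≠ m → ∃ w : ℂ, w ≠ 0 ∧ T j = w • T ⟨0, hk⟩ := by
  have h0 : ∀ j, T ⟨0, hk⟩ * T j = -(T j * T ⟨0, hk⟩) := by
    intro j
    by_cases hj : j = ⟨0, hk⟩
    · subst hj
      rw [← pow_two, hnil, neg_zero]
    · apply hanti
      rw [Fin.lt_def]
      exact Nat.pos_of_ne_zero fun h => hj (Fin.ext h)
  have hne : ∀ j, (∃ w : ℂ, T j = w • T ⟨0, hk⟩) → ∃ w : ℂ, w ≠ 0 ∧ T j = w • T ⟨0, hk⟩ := by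
    rintro j ⟨w, hw⟩
    refine ⟨w, ?_, hw⟩
    rintro rfl
    exact hnz j (by rw [hw, zero_smul])
  by_cases hall : ∀ j, ∃ w : ℂ, T j = w • T ⟨0, hk⟩
  · exact ⟨⟨0, hk⟩, fun j _ => hne j (hall j)⟩
  · obtain ⟨m, hm⟩ := not_forall.1 hall
    refine ⟨m, fun j hj => hne j ?_⟩
    have hac : T j * T m = -(T m * T j) := by
      rcases lt_or_gt_of_ne hj with h | h
      · exact hanti _ _ h
      · rw [hanti _ _ h, neg_neg]
    exact (stmt19_key _ _ _ (hnz _) hnil (h0 j) (h0 m) hac).resolve_right hm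
end
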